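/- arXiv:2407.11088 — 7 statements merged into one kernel-verified Lean document; each statement's English description precedes it below -/
import Mathlib

section
/- Let n ≥ 2 and let σ be a permutation of Fin n. Then the σ-orbit of 0 is all of Fin n (i.e., σ represents a single Hamiltonian tour) if and only if for every nonempty subset S of Fin n with 2·|S| ≤ n there exists a ∈ S with σ a ∉ S. (This is the correctness of the Dantzig–Fulkerson–Johnson sub-tour elimination constraints: a solution of the assignment constraints, encoded as a permutation, is a single tour exactly when every such subset S has an outgoing edge.) -/
theorem Equiv.Perm.apply_mem_finset_iff {α : Type*} (σ : Equiv.Perm α) {S : Finset α}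
    (h : ∀ a ∈ S, σ a ∈ S) (a : α) : σ a ∈ S ↔ a ∈ S := by
  refine ⟨fun ha => ?_, h a⟩
  have hmap : S.map σ.toEmbedding = S := by
    refine Finset.eq_of_subset_of_card_le ?_ (by simp)
    intro x hx
    obtain ⟨b, hb, rfl⟩ := Finset.mem_map.mp hx
    exact h b hb
  rw [← hmap] at ha
  simpa using ha

theorem Equiv.Perm.pow_apply_mem_finset_iff {α : Type*} (σ : Equiv.Perm α) {S : Finset α}
    (h : ∀ a ∈ S, σ a ∈ S) (k : ℕ) (a : α) : (σ ^ k) a ∈ S ↔ a ∈ S := by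
  induction k with
  | zero => simp
  | succ k ih => rw [pow_succ', Equiv.Perm.mul_apply, σ.apply_mem_finset_iff h, ih]

/-- Correctness of the Dantzig–Fulkerson–Johnson sub-tour elimination constraints:
a permutation `σ` of the cities `Fin n` (the successor map of a solution of the
assignment constraints) represents a single Hamiltonian tour (the `σ`-orbit of the
home city `0` is everything) iff for every nonempty subset `S` of cities with
`2·|S| ≤ n` the salesman passes from some city of `S` to a city outside `S`. -/
theorem dfj_subtour_elimination_correct (n : ℕ) [NeZero n] (hn : 2 ≤ n)
    (σ : Equiv.Perm (Fin n)) :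
    (∀ x : Fin n, ∃ k : ℕ, (σ ^ k) 0 = x) ↔
      (∀ S : Finset (Fin n), S.Nonempty → 2 * S.card ≤ n → ∃ a ∈ S, σ a ∉ S) := by
  classical
  constructor
  · intro horbit S hS hcard
    by_contra! hclosed
    obtain ⟨s, hs⟩ := hS
    have hiff (x : Fin n) : x ∈ S ↔ 0 ∈ S := by
      obtain ⟨k, rfl⟩ := horbit x
      exact σ.pow_apply_mem_finset_iff hclosed k 0
    have huniv : S = Finset.univ :=
      Finset.eq_univ_iff_forall.mpr fun x => (hiff x).mpr ((hiff s).mp hs)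
    rw [huniv, Finset.card_univ, Fintype.card_fin] at hcard
    omega
  · intro hcut x
    by_contra hx
    let O : Finset (Fin n) := Finset.univ.filter fun y => ∃ k : ℕ, (σ ^ k) 0 = y
    have hO (y : Fin n) : y ∈ O ↔ ∃ k : ℕ, (σ ^ k) 0 = y := by simp [O]
    have hclosed : ∀ a ∈ O, σ a ∈ O := by
      intro a ha
      obtain ⟨k, rfl⟩ := (hO a).mp ha
      exact (hO _).mpr ⟨k + 1, by rw [pow_succ', Equiv.Perm.mul_apply]⟩
    have hadd : O.card + Oᶜ.card = n := by
      rw [Finset.card_add_card_compl, Fintype.card_fin]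
    rcases le_total O.card Oᶜ.card with hle | hle
    · obtain ⟨a, ha, hσa⟩ := hcut O ⟨0, (hO 0).mpr ⟨0, rfl⟩⟩ (by omega)
      exact hσa (hclosed a ha)
    · obtain ⟨a, ha, hσa⟩ :=
        hcut Oᶜ ⟨x, Finset.mem_compl.mpr (mt (hO x).mp hx)⟩ (by omega)
      rw [Finset.mem_compl, σ.apply_mem_finset_iff hclosed] at hσa
      exact hσa (Finset.mem_compl.mp ha)
end

section
/- Let n ≥ 1, let σ be a permutation of Fin n, let d : Fin n × Fin n → ℝ be strictly positive, and let t : Fin n → ℝ satisfy t(σ a) ≥ t a + d(a, σ a) for every a ∈ Fin n with σ a ≠ 0. Then the σ-orbit of 0 is all of Fin n. (This is the sub-tour elimination property of the completion-time constraints (2.10) in the MTZ-type model of the cyclic scheduling problem: since all inter-activity times are positive, the completion-time inequalities along performed edges exclude any sub-cycle of activities avoiding the first activity.) -/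
/-- Sub-tour elimination property of the completion-time constraints (2.10) in
the MTZ-type model of the cyclic scheduling problem: if all inter-activity times
`d` are positive and the completion times satisfy `t (σ a) ≥ t a + d (a, σ a)`
along every performed edge not returning to the first activity `0`, then the
`σ`-orbit of `0` is all of `Fin n`. -/
theorem csp_completion_times_eliminate_subtours (n : ℕ) [NeZero n] (hn : 1 ≤ n)
    (σ : Equiv.Perm (Fin n)) (d : Fin n × Fin n → ℝ)
    (hd : ∀ p : Fin n × Fin n, 0 < d p)
    (t : Fin n → ℝ)
    (ht : ∀ a : Fin n, σ a ≠ 0 → t (σ a) ≥ t a + d (a, σ a)) :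
    ∀ x : Fin n, ∃ k : ℕ, (σ ^ k) 0 = x := by
  by_contra! h
  obtain ⟨x, hx, hmin⟩ := Set.exists_min_image {x | ∀ k : ℕ, (σ ^ k) 0 ≠ x} t
    (Set.toFinite _) h
  have hx0 : σ (σ.symm x) ≠ 0 := by
    simpa using (hx 0).symm
  have hpred : ∀ k : ℕ, (σ ^ k) 0 ≠ σ.symm x := fun k hk => hx (k + 1) <| by
    rw [pow_succ', Equiv.Perm.mul_apply, hk, Equiv.apply_symm_apply]
  have hle := hmin _ hpred
  have hstep := ht _ hx0
  rw [Equiv.apply_symm_apply] at hstep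
  linarith [hd (σ.symm x, x)]
end

section
/- Let n ≥ 1, let σ be a permutation of Fin n, and let f : Fin n → ℝ satisfy the flow-conservation equations f a = f(σ⁻¹ a) + 1 for every a ∈ Fin n with a ≠ 0 (the outflow at each non-home city equals its inflow plus 1). Then the σ-orbit of 0 is all of Fin n. (This is the sub-tour elimination property of the single-commodity network-flow TSP model of Gavish and Graves: a sub-tour of s > 0 cities avoiding the home city would force the flow entering any of its cities to equal itself plus s, a contradiction.) -/
/-- Sub-tour elimination property of the single-commodity network-flow TSP model
of Gavish and Graves: if the flow values `f` satisfy the conservation equations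
`f a = f (σ⁻¹ a) + 1` at every non-home city `a`, then the `σ`-orbit of the home
city `0` is all of `Fin n`. -/
theorem flow_model_eliminates_subtours (n : ℕ) [NeZero n] (hn : 1 ≤ n)
    (σ : Equiv.Perm (Fin n)) (f : Fin n → ℝ)
    (hflow : ∀ a : Fin n, a ≠ 0 → f a = f (σ⁻¹ a) + 1) :
    ∀ x : Fin n, ∃ k : ℕ, (σ ^ k) 0 = x := by
  intro x
  by_contra! hx
  have hne (k : ℕ) : (σ⁻¹ ^ k) x ≠ 0 := by
    intro h
    apply hx k
    rw [← h, ← Equiv.Perm.mul_apply, inv_pow, mul_inv_cancel, Equiv.Perm.one_apply]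
  have hdesc (k : ℕ) : f x = f ((σ⁻¹ ^ k) x) + k := by
    induction k with
    | zero => simp
    | succ k ih =>
      rw [ih, hflow _ (hne k), pow_succ', Equiv.Perm.mul_apply]
      push_cast
      ring
  have hcycle := hdesc (orderOf σ⁻¹)
  rw [pow_orderOf_eq_one, Equiv.Perm.one_apply] at hcycle
  have hpos : (0 : ℝ) < orderOf σ⁻¹ := by exact_mod_cast orderOf_pos σ⁻¹
  linarith
end

section
/- Let n ≥ 2 and let σ be a permutation of Fin n whose σ-orbit of 0 is all of Fin n. Then there exists f : Fin n → ℝ with 0 ≤ f a ≤ n − 1 for every a and f a = f(σ⁻¹ a) + 1 for every a ≠ 0 (one may take f(σ^k 0) = k for k = 0, 1, …, n − 1). Hence every Hamiltonian tour admits a feasible flow for the network-flow TSP model. -/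
/-- Every Hamiltonian tour admits a feasible flow for the network-flow TSP
model: if the `σ`-orbit of the home city `0` is all of `Fin n`, then there is a
flow `f : Fin n → ℝ` with `0 ≤ f a ≤ n − 1` for every `a` satisfying the
conservation equations `f a = f (σ⁻¹ a) + 1` at every non-home city. -/
theorem tour_admits_feasible_flow (n : ℕ) [NeZero n] (hn : 2 ≤ n)
    (σ : Equiv.Perm (Fin n))
    (htour : ∀ x : Fin n, ∃ k : ℕ, (σ ^ k) 0 = x) :
    ∃ f : Fin n → ℝ,
      (∀ a : Fin n, 0 ≤ f a ∧ f a ≤ (n : ℝ) - 1) ∧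
      (∀ a : Fin n, a ≠ 0 → f a = f (σ⁻¹ a) + 1) := by
  classical
  have hcycle : σ.IsCycleOn ((Finset.univ : Finset (Fin n)) : Set (Fin n)) := by
    have hzero (x : Fin n) : σ.SameCycle 0 x :=
      let ⟨k, hk⟩ := htour x
      ⟨k, by simpa using hk⟩
    refine ⟨?_, fun x _ y _ => (hzero x).symm.trans (hzero y)⟩
    simp
  refine ⟨fun a => (Nat.find (htour a) : ℝ), fun a => ⟨Nat.cast_nonneg _, ?_⟩, fun a ha => ?_⟩
  · obtain ⟨k, hk, hka⟩ := hcycle.exists_pow_eq (Finset.mem_coe.2 (Finset.mem_univ 0))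
      (Finset.mem_coe.2 (Finset.mem_univ a))
    have hlt : Nat.find (htour a) < n := (Nat.find_min' (htour a) hka).trans_lt (by simpa using hk)
    rw [le_sub_iff_add_le]
    beta_reduce
    exact_mod_cast hlt
  · have hfind : Nat.find (htour a) = Nat.find (htour (σ⁻¹ a)) + 1 := by
      apply le_antisymm
      · refine Nat.find_min' (htour a) ?_
        rw [pow_succ', Equiv.Perm.mul_apply, Nat.find_spec (htour (σ⁻¹ a))]
        simp
      · have hspec := Nat.find_spec (htour a)
        rcases hm : Nat.find (htour a) with _ | m
        · rw [hm] at hspec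
          exact absurd hspec.symm ha
        · rw [hm, pow_succ', Equiv.Perm.mul_apply] at hspec
          exact Nat.succ_le_succ
            (Nat.find_min' (htour (σ⁻¹ a)) (Equiv.Perm.eq_inv_iff_eq.2 hspec))
    beta_reduce
    exact_mod_cast hfind
end

section
/- Let n ≥ 2 and let v : Fin n → Fin n → Fin n → Prop (v a b s meaning 'the salesman passes from city a to city b at step s') satisfy: (i) v a b s implies a ≠ b, and for every a there is exactly one pair (b, s) with v a b s; (ii) for every b ≠ 0 and every step s with s.val + 1 ≤ n − 1, (∃ a, v a b s) holds if and only if (∃ k, v b k (s+1)) holds; (iii) for every b there is exactly one pair (a, s) with v a b s; (iv) for every s there is exactly one pair (a, b) with v a b s. Then the successor map σ, sending each a to the unique b such that v a b s holds for some s, is a permutation of Fin n whose σ-orbit of 0 is all of Fin n. (This is the correctness of Vajda's n-step TSP model: every feasible solution is a single Hamiltonian tour.) -/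
/-- A bijection `B` of `Fin n` that agrees with `s ↦ A (s + 1)`, for a bijection `A`, at every
`s` but the last one also agrees with it at the last one. -/
theorem eq_succ_of_eq_succ_of_lt {n : ℕ} [NeZero n] {α : Type*} {A B : Fin n → α}
    (hA : Function.Surjective A) (hB : Function.Injective B)
    (h : ∀ s : Fin n, s.val + 1 ≤ n - 1 → B s = A (s + 1)) (s : Fin n) : B s = A (s + 1) := by
  by_cases hs : s.val + 1 ≤ n - 1
  · exact h s hs
  obtain ⟨j, hj⟩ := hA (B s)
  by_cases hj' : (j - 1).val + 1 ≤ n - 1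
  · have hBj := h (j - 1) hj'
    rw [sub_add_cancel, hj] at hBj
    rw [← hB hBj, sub_add_cancel, hj, hB hBj]
  · have hjs : j - 1 = s := Fin.ext (by omega)
    rw [← hjs, sub_add_cancel, hj, hjs]

/-- A permutation that shifts a surjective enumeration by `Fin n` cyclically is transitive. -/
theorem exists_pow_apply_eq_of_apply_eq_succ {n : ℕ} [NeZero n] {α : Type*} {A : Fin n → α}
    (hA : Function.Surjective A) (σ : Equiv.Perm α) (hσ : ∀ s, σ (A s) = A (s + 1)) (x y : α) :
    ∃ k : ℕ, (σ ^ k) x = y := by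
  obtain ⟨p, rfl⟩ := hA x
  obtain ⟨q, rfl⟩ := hA y
  have hpow : ∀ k : ℕ, (σ ^ k) (A p) = A (p + Fin.ofNat n k) := by
    intro k
    induction k with
    | zero => simp
    | succ k ih =>
      rw [pow_succ', Equiv.Perm.mul_apply, ih, hσ, add_assoc]
      congr 2
      ext
      simp [Fin.val_add]
  refine ⟨(q - p).val, ?_⟩
  rw [hpow, Fin.ofNat_val_eq_self, add_sub_cancel]


/-- Correctness of Vajda's n-step TSP model: if `v a b s` ("the salesman passes
from city `a` to city `b` at step `s`") satisfies
(i) `v a b s → a ≠ b` and every city is left exactly once,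
(ii) a non-home city entered at step `s` is left at step `s+1` and conversely,
(iii) every city is entered exactly once,
(iv) at every step exactly one move is made,
then the induced successor map is a permutation of `Fin n` whose orbit of the
home city `0` is all of `Fin n`. -/
theorem vajda_model_correct (n : ℕ) [NeZero n] (hn : 2 ≤ n)
    (v : Fin n → Fin n → Fin n → Prop)
    (h_ne : ∀ a b s : Fin n, v a b s → a ≠ b)
    (h_leave : ∀ a : Fin n, ∃! bs : Fin n × Fin n, v a bs.1 bs.2)
    (h_chain : ∀ b : Fin n, b ≠ 0 → ∀ s : Fin n, s.val + 1 ≤ n - 1 →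
      ((∃ a : Fin n, v a b s) ↔ ∃ k : Fin n, v b k (s + 1)))
    (h_enter : ∀ b : Fin n, ∃! as : Fin n × Fin n, v as.1 b as.2)
    (h_step : ∀ s : Fin n, ∃! ab : Fin n × Fin n, v ab.1 ab.2 s) :
    ∃ σ : Equiv.Perm (Fin n),
      (∀ a b s : Fin n, v a b s → σ a = b) ∧
      (∀ x : Fin n, ∃ k : ℕ, (σ ^ k) 0 = x) := by
  choose m hm hm' using h_step
  let A : Fin n → Fin n := fun s => (m s).1
  let B : Fin n → Fin n := fun s => (m s).2
  have hAB : ∀ a b s, v a b s → A s = a ∧ B s = b := fun a b s h => by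
    have hs := hm' s (a, b) h
    exact ⟨(congrArg Prod.fst hs).symm, (congrArg Prod.snd hs).symm⟩
  have hA : Function.Bijective A := Finite.surjective_iff_bijective.mp fun a => by
    obtain ⟨bs, h, -⟩ := h_leave a
    exact ⟨bs.2, (hAB _ _ _ h).1⟩
  have hB : Function.Bijective B := Finite.surjective_iff_bijective.mp fun b => by
    obtain ⟨as, h, -⟩ := h_enter b
    exact ⟨as.2, (hAB _ _ _ h).2⟩
  have h_succ : ∀ s, B s = A (s + 1) := by
    refine eq_succ_of_eq_succ_of_lt hA.2 hB.1 fun s hs => ?_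
    by_cases hb : B s = 0
    · by_cases ha : A (s + 1) = 0
      · rw [hb, ha]
      · obtain ⟨a, h⟩ := (h_chain _ ha s hs).mpr ⟨_, hm (s + 1)⟩
        exact (hAB _ _ _ h).2
    · obtain ⟨k, h⟩ := (h_chain _ hb s hs).mp ⟨_, hm s⟩
      exact (hAB _ _ _ h).1.symm
  let σ : Equiv.Perm (Fin n) := (Equiv.ofBijective A hA).symm.trans (Equiv.ofBijective B hB)
  have hσ : ∀ s, σ (A s) = B s := fun s =>
    congrArg B ((Equiv.ofBijective A hA).symm_apply_apply s)
  refine ⟨σ, fun a b s h => ?_, exists_pow_apply_eq_of_apply_eq_succ hA.2 σ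
    (fun s => (hσ s).trans (h_succ s)) 0⟩
  obtain ⟨rfl, rfl⟩ := hAB a b s h
  exact hσ s
end

section
/- Let n ≥ 2 and let σ be a permutation of Fin n whose σ-orbit of 0 is all of Fin n. Define v : Fin n → Fin n → Fin n → Prop by v a b s ↔ (a = σ^(s.val) 0 ∧ b = σ a). Then v satisfies: (i) v a b s implies a ≠ b, and for every a there is exactly one pair (b, s) with v a b s; (ii) for every b ≠ 0 and every step s with s.val + 1 ≤ n − 1, (∃ a, v a b s) holds if and only if (∃ k, v b k (s+1)) holds; (iii) for every b there is exactly one pair (a, s) with v a b s; (iv) for every s there is exactly one pair (a, b) with v a b s. Hence every Hamiltonian tour yields a feasible solution of Vajda's n-step TSP model. -/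
/-- If every point is a forward iterate of `x` under a permutation of `Fin n`, then the first `n`
iterates of `x` enumerate `Fin n` without repetition. -/
theorem Equiv.Perm.bijective_pow_apply_of_forall_exists {n : ℕ} (σ : Equiv.Perm (Fin n))
    (x : Fin n) (h : ∀ y, ∃ k : ℕ, (σ ^ k) x = y) :
    Function.Bijective fun s : Fin n ↦ (σ ^ s.val) x := by
  set p := Function.minimalPeriod σ x
  have hp : 0 < p := Function.minimalPeriod_pos_of_mem_periodicPts
    (σ.injective.mem_periodicPts x)
  have hsurj : Function.Surjective fun s : Fin p ↦ (σ ^ s.val) x := by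
    intro y
    obtain ⟨k, rfl⟩ := h y
    refine ⟨⟨k % p, Nat.mod_lt k hp⟩, ?_⟩
    simp only [Equiv.Perm.coe_pow]
    exact Function.iterate_mod_minimalPeriod_eq
  have hle : n ≤ p := by simpa using Fintype.card_le_of_surjective _ hsurj
  refine Finite.injective_iff_bijective.mp fun s t hst ↦ Fin.ext ?_
  refine Function.iterate_injOn_Iio_minimalPeriod (f := σ) (x := x)
    (s.isLt.trans_le hle) (t.isLt.trans_le hle) ?_
  simpa [Equiv.Perm.coe_pow] using hst

/-- Every Hamiltonian tour yields a feasible solution of Vajda's n-step TSP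
model: if the `σ`-orbit of the home city `0` is all of `Fin n` and
`v a b s ↔ (a = σ^(s.val) 0 ∧ b = σ a)`, then `v` satisfies
(i) `v a b s → a ≠ b` and every city is left exactly once,
(ii) a non-home city entered at step `s` is left at step `s+1` and conversely,
(iii) every city is entered exactly once,
(iv) at every step exactly one move is made. -/
theorem tour_feasible_for_vajda (n : ℕ) [NeZero n] (hn : 2 ≤ n)
    (σ : Equiv.Perm (Fin n))
    (htour : ∀ x : Fin n, ∃ k : ℕ, (σ ^ k) 0 = x)
    (v : Fin n → Fin n → Fin n → Prop)
    (hv : ∀ a b s : Fin n, v a b s ↔ (a = (σ ^ s.val) 0 ∧ b = σ a)) :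
    (∀ a b s : Fin n, v a b s → a ≠ b) ∧
    (∀ a : Fin n, ∃! bs : Fin n × Fin n, v a bs.1 bs.2) ∧
    (∀ b : Fin n, b ≠ 0 → ∀ s : Fin n, s.val + 1 ≤ n - 1 →
      ((∃ a : Fin n, v a b s) ↔ ∃ k : Fin n, v b k (s + 1))) ∧
    (∀ b : Fin n, ∃! as : Fin n × Fin n, v as.1 b as.2) ∧
    (∀ s : Fin n, ∃! ab : Fin n × Fin n, v ab.1 ab.2 s) := by
  have hbij := σ.bijective_pow_apply_of_forall_exists 0 htour
  have hfix : ∀ a, σ a ≠ a := by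
    intro a ha
    have hconst : ∀ x, x = a := by
      intro x
      obtain ⟨i, hi⟩ := htour a
      obtain ⟨j, hj⟩ := htour x
      have h0 : (0 : Fin n) = a :=
        (σ ^ i).injective (hi.trans (Equiv.Perm.pow_apply_eq_self_of_apply_eq_self ha i).symm)
      rw [← hj, h0, Equiv.Perm.pow_apply_eq_self_of_apply_eq_self ha j]
    have h01 := (hconst ⟨0, by lia⟩).trans (hconst ⟨1, by lia⟩).symm
    simp at h01
  simp only [hv]
  refine ⟨?_, ?_, ?_, ?_, ?_⟩
  · rintro a b s ⟨-, rfl⟩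
    exact (hfix a).symm
  · intro a
    obtain ⟨s, hs⟩ := hbij.2 a
    refine ⟨(σ a, s), ⟨hs.symm, rfl⟩, ?_⟩
    rintro ⟨b, t⟩ ⟨ht, rfl⟩
    exact Prod.ext rfl (hbij.1 (ht.symm.trans hs.symm))
  · intro b _ s hs
    have hval : (s + 1).val = s.val + 1 := Fin.val_add_one_of_lt' (by lia)
    simp [hval, pow_succ']
  · intro b
    obtain ⟨s, hs⟩ := hbij.2 (σ.symm b)
    refine ⟨(σ.symm b, s), ⟨hs.symm, by simp⟩, ?_⟩
    rintro ⟨a, t⟩ ⟨ht, hb⟩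
    have ha : a = σ.symm b := by simp [hb]
    exact Prod.ext ha (hbij.1 (ht.symm.trans (ha.trans hs.symm)))
  · intro s
    refine ⟨((σ ^ s.val) 0, σ ((σ ^ s.val) 0)), ⟨rfl, rfl⟩, ?_⟩
    rintro ⟨a, b⟩ ⟨ha, hb⟩
    exact Prod.ext ha (hb.trans (congrArg σ ha))
end

section
/- Let q, C, t_L, t_U, M be real numbers with q > 0, C ≥ 0, and M ≥ q + |t_L − t_U|. Then there exists z ∈ {0, 1} satisfying the three big-M constraints t_U − t_L ≤ M·z, t_U ≥ t_L + q − M·(1 − z), and t_L ≤ t_U + C − q·(1 − z) if and only if either t_U ≥ t_L + q, or (t_U ≤ t_L and C − t_L + t_U ≥ q). (This is the correctness of constraints (2.11)–(2.13) of the MTZ-type cyclic scheduling model: for each machine, the binary variable z together with the big-M constraints enforces that the time between loading and unloading — measured within the cycle, wrapping around the cycle of length C when the unloading precedes the loading — is at least the required minimum q.) -/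
/-- Correctness of constraints (2.11)–(2.13) of the MTZ-type cyclic scheduling
model: given a required time `q > 0`, a cycle time `C ≥ 0`, and a big-M constant
`M ≥ q + |t_L − t_U|`, there is a binary `z` satisfying
`t_U − t_L ≤ M·z`, `t_U ≥ t_L + q − M·(1−z)`, `t_L ≤ t_U + C − q·(1−z)`
iff either the unloading completes at least `q` after the loading, or it
precedes the loading and the wrap-around time `C − t_L + t_U` is at least `q`. -/
theorem bigM_loading_unloading_correct (q C tL tU M : ℝ)
    (hq : 0 < q) (hC : 0 ≤ C) (hM : q + |tL - tU| ≤ M) :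
    (∃ z : ℝ, (z = 0 ∨ z = 1) ∧
        tU - tL ≤ M * z ∧
        tU ≥ tL + q - M * (1 - z) ∧
        tL ≤ tU + C - q * (1 - z)) ↔
      (tU ≥ tL + q ∨ (tU ≤ tL ∧ C - tL + tU ≥ q)) := by
  have h₁ := le_abs_self (tL - tU)
  have h₂ := neg_abs_le (tL - tU)
  constructor
  · rintro ⟨z, rfl | rfl, hz₁, hz₂, hz₃⟩
    · right
      constructor <;> linarith
    · left
      linarith
  · rintro (h | ⟨h, hw⟩)
    · refine ⟨1, Or.inr rfl, ?_, ?_, ?_⟩ <;> linarith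
    · refine ⟨0, Or.inl rfl, ?_, ?_, ?_⟩ <;> linarith
end
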